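/- arXiv:2604.24130 — 3 statements merged into one kernel-verified Lean document; each statement's English description precedes it below -/
import Mathlib

section
/- For every integer n ≥ 1 there exists j ≥ 0 such that the functions x ↦ sin(nx) and x ↦ cos(nx) both belong to H_j. -/
open Real

/-- The increasing sequence of subspaces `H_j ⊆ L²₀(𝕋)` (identified with `2π`-periodic
functions `ℝ → ℝ`): `H₀ = span{sin, cos}` and
`H_j = span{ η − ∑_{l=1}^N ζ_l ∂ₓζ_l : N ∈ ℕ, η, ζ_l ∈ H_{j−1} }`. -/
noncomputable def Hspace : ℕ → Submodule ℝ (ℝ → ℝ)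
  | 0 => Submodule.span ℝ {fun x => Real.sin x, fun x => Real.cos x}
  | (j + 1) => Submodule.span ℝ
      {f | ∃ (η : ℝ → ℝ) (N : ℕ) (ζ : Fin N → ℝ → ℝ),
        η ∈ Hspace j ∧ (∀ l, ζ l ∈ Hspace j) ∧
        f = η - ∑ l : Fin N, fun x => ζ l x * deriv (ζ l) x}

theorem Hspace_le_succ (j : ℕ) : Hspace j ≤ Hspace (j + 1) := by
  intro f hf
  rw [Hspace]
  exact Submodule.subset_span ⟨f, 0, Fin.elim0, hf, fun l => l.elim0, by simp⟩

theorem Hspace_mono : Monotone Hspace := monotone_nat_of_le_succ Hspace_le_succ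

theorem mul_deriv_mem_Hspace_succ {j : ℕ} {f : ℝ → ℝ} (hf : f ∈ Hspace j) :
    (fun x => f x * deriv f x) ∈ Hspace (j + 1) := by
  rw [← Submodule.neg_mem_iff, Hspace]
  exact Submodule.subset_span ⟨0, 1, fun _ => f, zero_mem _, fun _ => hf, by simp⟩

/-- Polarization: the derivative of a product of two differentiable elements of `H_j` lies in
`H_{j+1}`. -/
theorem deriv_mul_mem_Hspace_succ {j : ℕ} {f g : ℝ → ℝ} (hf : f ∈ Hspace j) (hg : g ∈ Hspace j)
    (hf' : Differentiable ℝ f) (hg' : Differentiable ℝ g) :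
    deriv (f * g) ∈ Hspace (j + 1) := by
  convert sub_mem (sub_mem (mul_deriv_mem_Hspace_succ (add_mem hf hg))
    (mul_deriv_mem_Hspace_succ hf)) (mul_deriv_mem_Hspace_succ hg) using 1
  ext x
  simp only [Pi.sub_apply, Pi.add_apply, deriv_mul (hf' x) (hg' x), deriv_add (hf' x) (hg' x)]
  ring

/-- For every integer `n ≥ 1` there exists `j ≥ 0` such that both `x ↦ sin (n x)` and
`x ↦ cos (n x)` belong to `H_j`. -/
theorem sin_cos_mem_Hspace (n : ℕ) (hn : 1 ≤ n) :
    ∃ j : ℕ, (fun x : ℝ => Real.sin (n * x)) ∈ Hspace j ∧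
      (fun x : ℝ => Real.cos (n * x)) ∈ Hspace j := by
  have sin_mem : (fun x => Real.sin x) ∈ Hspace 0 := by
    rw [Hspace]; exact Submodule.subset_span (by simp)
  have cos_mem : (fun x => Real.cos x) ∈ Hspace 0 := by
    rw [Hspace]; exact Submodule.subset_span (by simp)
  induction n, hn using Nat.le_induction with
  | base => exact ⟨0, by simpa using sin_mem, by simpa using cos_mem⟩
  | succ n hn ih =>
    obtain ⟨j, hs, hc⟩ := ih
    replace sin_mem := Hspace_mono j.zero_le sin_mem
    replace cos_mem := Hspace_mono j.zero_le cos_mem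
    have hn0 : (n + 1 : ℝ) ≠ 0 := by positivity
    have deriv_sin_mul (m x : ℝ) : deriv (fun x => Real.sin (m * x)) x = m * Real.cos (m * x) := by
      simpa [mul_comm] using (((hasDerivAt_id x).const_mul m).sin).deriv
    have deriv_cos_mul (m x : ℝ) :
        deriv (fun x => Real.cos (m * x)) x = -(m * Real.sin (m * x)) := by
      simpa [mul_comm] using (((hasDerivAt_id x).const_mul m).cos).deriv
    have ds : Differentiable ℝ fun x : ℝ => Real.sin (n * x) := by fun_prop
    have dc : Differentiable ℝ fun x : ℝ => Real.cos (n * x) := by fun_prop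
    have ds1 : Differentiable ℝ fun x : ℝ => Real.sin x := by fun_prop
    have dc1 : Differentiable ℝ fun x : ℝ => Real.cos x := by fun_prop
    refine ⟨j + 1, ?_, ?_⟩
    · convert (Hspace (j + 1)).smul_mem (-(n + 1 : ℝ)⁻¹)
        (sub_mem (deriv_mul_mem_Hspace_succ hc cos_mem dc dc1)
          (deriv_mul_mem_Hspace_succ hs sin_mem ds ds1)) using 1
      ext x
      simp only [Pi.smul_apply, Pi.sub_apply, smul_eq_mul, deriv_mul (dc x) (dc1 x),
        deriv_mul (ds x) (ds1 x), deriv_sin_mul, deriv_cos_mul, Real.deriv_sin, Real.deriv_cos]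
      push_cast
      rw [add_mul, one_mul, Real.sin_add]
      field_simp
      ring
    · convert (Hspace (j + 1)).smul_mem ((n + 1 : ℝ)⁻¹)
        (add_mem (deriv_mul_mem_Hspace_succ hs cos_mem ds dc1)
          (deriv_mul_mem_Hspace_succ hc sin_mem dc ds1)) using 1
      ext x
      simp only [Pi.smul_apply, Pi.add_apply, smul_eq_mul, deriv_mul (dc x) (ds1 x),
        deriv_mul (ds x) (dc1 x), deriv_sin_mul, deriv_cos_mul, Real.deriv_sin, Real.deriv_cos]
      push_cast
      rw [add_mul, one_mul, Real.cos_add]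
      field_simp
      ring
end

section
/- Gauge function H¹ bound: let F : ℝ → ℝ be continuously differentiable and 2π-periodic with ∫₀^{2π} F(x) dx = 0. Then ∫₀^{2π} |e^{iF(x)/2} − 1|² dx + ∫₀^{2π} |(d/dx)(e^{iF(x)/2})|² dx ≤ ∫₀^{2π} |F′(x)|² dx. -/
open Real Complex intervalIntegral

open MeasureTheory Set in
/-- **Wirtinger's inequality** on an interval, for functions of zero mean with equal boundary
values and square-integrable derivative. -/
theorem integral_norm_sq_le_integral_norm_deriv_sq {a b : ℝ} (hab : a < b) {f f' : ℝ → ℂ}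
    (hf : ∀ x ∈ uIcc a b, HasDerivAt f (f' x) x)
    (hf' : MemLp f' 2 (volume.restrict (Ioc a b)))
    (hbd : f a = f b) (hmean : ∫ x in a..b, f x = 0) :
    ∫ x in a..b, ‖f x‖ ^ 2 ≤ ((b - a) / (2 * π)) ^ 2 * ∫ x in a..b, ‖f' x‖ ^ 2 := by
  have hL : 0 < b - a := sub_pos.2 hab
  have hint : IntervalIntegrable f' volume a b :=
    (intervalIntegrable_iff_integrableOn_Ioc_of_le hab.le).2
      (hf'.integrable (by norm_num))
  have hcont : ContinuousOn f (Icc a b) := fun x hx =>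
    (hf x (uIcc_of_le hab.le ▸ hx)).continuousAt.continuousWithinAt
  have hfL2 : MemLp f 2 (volume.restrict (Ioc a b)) := by
    obtain ⟨C, hC⟩ := isCompact_Icc.exists_bound_of_continuousOn hcont
    refine MemLp.of_bound ((hcont.mono Ioc_subset_Icc_self).aestronglyMeasurable
      measurableSet_Ioc) C ?_
    filter_upwards [ae_restrict_mem measurableSet_Ioc] with x hx
      using hC x (Ioc_subset_Icc_self hx)
  have hcoeff (n : ℤ) : ‖fourierCoeffOn hab f n‖ ^ 2 ≤
      ((b - a) / (2 * π)) ^ 2 * ‖fourierCoeffOn hab f' n‖ ^ 2 := by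
    rcases eq_or_ne n 0 with rfl | hn
    · rw [fourierCoeffOn_eq_integral f]
      simp only [neg_zero, fourier_zero, one_smul, hmean, smul_zero, norm_zero, zero_pow two_ne_zero]
      positivity
    · have hn1 : (1 : ℝ) ≤ |(n : ℝ)| := by exact_mod_cast Int.one_le_abs hn
      have hnorm : ‖fourierCoeffOn hab f n‖ =
          (b - a) / (2 * π) * ‖fourierCoeffOn hab f' n‖ / |(n : ℝ)| := by
        rw [fourierCoeffOn_of_hasDerivAt hab hn hf hint, hbd, sub_self, mul_zero, zero_sub,
          ← Complex.ofReal_sub]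
        simp only [norm_mul, norm_div, norm_neg, norm_one, norm_real, norm_I, norm_intCast,
          Complex.norm_ofNat, Real.norm_eq_abs, abs_of_pos hL, abs_of_pos pi_pos, mul_one]
        ring
      rw [hnorm, ← mul_pow]
      gcongr
      exact div_le_self (by positivity) hn1
  have hle := hasSum_le hcoeff (hasSum_sq_fourierCoeffOn hab hfL2)
    ((hasSum_sq_fourierCoeffOn hab hf').mul_left _)
  rw [smul_eq_mul, smul_eq_mul, mul_left_comm] at hle
  exact le_of_mul_le_mul_left hle (inv_pos.2 hL)

/-- **Gauge function `H¹` bound.** If `F : ℝ → ℝ` is `C¹`, `2π`-periodic with zero mean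
over one period, then
`∫₀^{2π} |e^{iF/2} − 1|² + ∫₀^{2π} |(e^{iF/2})′|² ≤ ∫₀^{2π} |F′|²`. -/
theorem gauge_H1_bound (F : ℝ → ℝ) (hF : ContDiff ℝ 1 F)
    (hper : ∀ x : ℝ, F (x + 2 * π) = F x)
    (hmean : ∫ x in (0:ℝ)..(2 * π), F x = 0) :
    (∫ x in (0:ℝ)..(2 * π), ‖Complex.exp (Complex.I * F x / 2) - 1‖ ^ 2) +
      (∫ x in (0:ℝ)..(2 * π),
        ‖deriv (fun y : ℝ => Complex.exp (Complex.I * F y / 2)) x‖ ^ 2) ≤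
    ∫ x in (0:ℝ)..(2 * π), (deriv F x) ^ 2 := by
  have hcF : Continuous F := hF.continuous
  have hcF' : Continuous (deriv F) := hF.continuous_deriv le_rfl
  have hderiv (x : ℝ) : HasDerivAt F (deriv F x) x :=
    (hF.differentiable one_ne_zero x).hasDerivAt
  have harg (x : ℝ) : Complex.I * F x / 2 = Complex.I * ((F x / 2 : ℝ) : ℂ) := by
    push_cast; ring
  have hwirtinger : ∫ x in (0:ℝ)..(2 * π), F x ^ 2 ≤ ∫ x in (0:ℝ)..(2 * π), deriv F x ^ 2 := by
    have hL2 : MeasureTheory.MemLp (fun x => ((deriv F x : ℝ) : ℂ)) 2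
        (MeasureTheory.volume.restrict (Set.Ioc 0 (2 * π))) := by
      obtain ⟨C, hC⟩ := (isCompact_Icc (a := (0:ℝ)) (b := 2 * π)).exists_bound_of_continuousOn
        (continuous_ofReal.comp hcF').continuousOn
      refine .of_bound (continuous_ofReal.comp hcF').aestronglyMeasurable C ?_
      filter_upwards [MeasureTheory.ae_restrict_mem measurableSet_Ioc] with x hx
        using hC x (Set.Ioc_subset_Icc_self hx)
    have h := integral_norm_sq_le_integral_norm_deriv_sq two_pi_pos
      (f := fun x => (F x : ℂ)) (fun x _ => (hderiv x).ofReal_comp) hL2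
      (by simpa using (hper 0).symm) (by rw [intervalIntegral.integral_ofReal, hmean, ofReal_zero])
    simpa [two_pi_pos.ne', div_self two_pi_pos.ne'] using h
  have hexp : ∫ x in (0:ℝ)..(2 * π), ‖Complex.exp (Complex.I * F x / 2) - 1‖ ^ 2 ≤
      ∫ x in (0:ℝ)..(2 * π), F x ^ 2 / 4 := by
    refine integral_mono_on two_pi_pos.le (Continuous.intervalIntegrable (by fun_prop) _ _)
      (Continuous.intervalIntegrable (by fun_prop) _ _) fun x _ => ?_
    rw [harg]
    calc ‖Complex.exp (Complex.I * ((F x / 2 : ℝ) : ℂ)) - 1‖ ^ 2 ≤ ‖F x / 2‖ ^ 2 := by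
          gcongr; exact norm_exp_I_mul_ofReal_sub_one_le
      _ = F x ^ 2 / 4 := by rw [Real.norm_eq_abs, sq_abs]; ring
  have hexp' (x : ℝ) : ‖deriv (fun y : ℝ => Complex.exp (Complex.I * F y / 2)) x‖ ^ 2 =
      deriv F x ^ 2 / 4 := by
    have h := (((hderiv x).ofReal_comp.const_mul Complex.I).div_const 2).cexp
    rw [h.deriv, harg, norm_mul, norm_exp_I_mul_ofReal]
    simp only [norm_div, norm_mul, norm_I, norm_real, Complex.norm_ofNat, one_mul, div_pow,
      Real.norm_eq_abs, sq_abs]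
    norm_num
  simp only [hexp', intervalIntegral.integral_div] at hexp ⊢
  have hnonneg : 0 ≤ ∫ x in (0:ℝ)..(2 * π), deriv F x ^ 2 :=
    intervalIntegral.integral_nonneg two_pi_pos.le fun x _ => sq_nonneg _
  linarith
end

section
/- Equation for the antiderivative (first step of Tao's gauge transform): let T > 0 and let u, g : [0,T] × ℝ → ℝ be smooth, 2π-periodic in x, with ∫₀^{2π} u(t,x) dx = ∫₀^{2π} g(t,x) dx = 0 for every t, and suppose ∂ₜu + H∂ₓ²u + u∂ₓu = g pointwise. Let F(t,·) be the unique smooth 2π-periodic function with ∂ₓF(t,·) = u(t,·) and ∫₀^{2π} F(t,x) dx = 0, and define G(t,·) analogously from g. Then, pointwise on [0,T] × ℝ, ∂ₜF + H∂ₓ²F + (1/2)(∂ₓF)² = (1/4π)∫₀^{2π} (∂ₓF(t,y))² dy + G. -/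
open Real Complex MeasureTheory intervalIntegral

/-- The `k`-th Fourier coefficient `f̂(k) = (1/2π) ∫₀^{2π} f(x) e^{−ikx} dx` of a
(`2π`-periodic) function `f : ℝ → ℂ`. -/
noncomputable def fourierCoef (f : ℝ → ℂ) (k : ℤ) : ℂ :=
  (1 / (2 * π)) * ∫ x in (0:ℝ)..(2 * π), f x * Complex.exp (-Complex.I * k * x)

/-- The periodic Hilbert transform `(Hf)(x) = Σ_{k∈ℤ} (−i sgn k) f̂(k) e^{ikx}` of a
(`2π`-periodic, smooth) function `f : ℝ → ℂ`; the series converges absolutely for smooth `f`. -/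
noncomputable def hilbertC (f : ℝ → ℂ) (x : ℝ) : ℂ :=
  ∑' k : ℤ, (-Complex.I * (Int.sign k : ℂ)) * fourierCoef f k * Complex.exp (Complex.I * k * x)

/-- The periodic Hilbert transform of a real-valued function: for real `f` the series
`Σ_{k∈ℤ} (−i sgn k) f̂(k) e^{ikx}` is real-valued, and we record its real part. -/
noncomputable def hilbertR (f : ℝ → ℝ) (x : ℝ) : ℝ :=
  (hilbertC (fun y => (f y : ℂ)) x).re

theorem fourierCoef_deriv {f : ℝ → ℂ} (hf : ContDiff ℝ 1 f)
    (hper : Function.Periodic f (2 * π)) (k : ℤ) :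
    fourierCoef (deriv f) k = Complex.I * k * fourierCoef f k := by
  have hexp (x : ℝ) : HasDerivAt (fun y : ℝ => Complex.exp (-Complex.I * k * y))
      (Complex.exp (-Complex.I * k * x) * (-Complex.I * k)) x := by
    simpa using (((hasDerivAt_id x).ofReal_comp).const_mul (-Complex.I * k)).cexp
  have hcont : Continuous fun x : ℝ => Complex.exp (-Complex.I * k * x) * (-Complex.I * k) := by
    fun_prop
  have hparts := intervalIntegral.integral_mul_deriv_eq_deriv_mul (a := 0) (b := 2 * π)
    (fun x _ => (hf.differentiable one_ne_zero x).hasDerivAt) (fun x _ => hexp x)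
    ((hf.continuous_deriv le_rfl).intervalIntegrable _ _) (hcont.intervalIntegrable _ _)
  have hend : Complex.exp (-Complex.I * k * ((2 * π : ℝ) : ℂ)) = 1 := by
    rw [Complex.exp_eq_one_iff]
    exact ⟨-k, by push_cast; ring⟩
  have hf0 : f (2 * π) = f 0 := by simpa using hper 0
  have hmul : ∫ x in (0:ℝ)..(2 * π), f x * (Complex.exp (-Complex.I * k * x) * (-Complex.I * k)) =
      (∫ x in (0:ℝ)..(2 * π), f x * Complex.exp (-Complex.I * k * x)) * (-Complex.I * k) := by
    rw [← intervalIntegral.integral_mul_const]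
    simp only [mul_assoc]
  rw [hmul, hend, hf0] at hparts
  simp only [ofReal_zero, mul_zero, Complex.exp_zero, sub_self, zero_sub] at hparts
  unfold fourierCoef
  rw [← neg_eq_iff_eq_neg.mpr hparts]
  ring

theorem norm_fourierCoef_le (f : ℝ → ℂ) (k : ℤ) :
    ‖fourierCoef f k‖ ≤ ‖(1 / (2 * π) : ℂ)‖ * ∫ x in (0:ℝ)..(2 * π), ‖f x‖ := by
  rw [fourierCoef, norm_mul]
  gcongr
  refine (intervalIntegral.norm_integral_le_integral_norm Real.two_pi_pos.le).trans_eq ?_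
  refine intervalIntegral.integral_congr fun x _ => ?_
  simp [Complex.norm_exp]

theorem Function.Periodic.deriv {f : ℝ → ℂ} {c : ℝ} (hper : Function.Periodic f c) :
    Function.Periodic (deriv f) c := fun x => by
  rw [← deriv_comp_add_const, hper.funext]

theorem exists_norm_fourierCoef_deriv_le {f : ℝ → ℂ} (hf : ContDiff ℝ 3 f)
    (hper : Function.Periodic f (2 * π)) :
    ∃ C : ℝ, ∀ k : ℤ, k ≠ 0 → ‖fourierCoef (deriv f) k‖ ≤ C * (1 / (k : ℝ) ^ 2) := by
  have hf1 : ContDiff ℝ 2 (deriv f) := hf.deriv'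
  have hf2 : ContDiff ℝ 1 (deriv (deriv f)) := hf1.deriv'
  refine ⟨‖(1 / (2 * π) : ℂ)‖ * ∫ x in (0:ℝ)..(2 * π), ‖deriv (deriv (deriv f)) x‖,
    fun k hk => ?_⟩
  have h := norm_fourierCoef_le (deriv (deriv (deriv f))) k
  have hk0 : 0 < (k : ℝ) ^ 2 := by positivity
  rw [fourierCoef_deriv hf2 hper.deriv.deriv,
    fourierCoef_deriv (hf1.of_le one_le_two) hper.deriv,
    norm_mul, norm_mul, norm_mul, norm_mul, Complex.norm_I, Complex.norm_intCast, one_mul,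
    ← mul_assoc, ← sq, sq_abs] at h
  rwa [mul_one_div, le_div_iff₀ hk0, mul_comm]

theorem hasDerivAt_hilbertC {f : ℝ → ℂ} (hf : ContDiff ℝ 3 f)
    (hper : Function.Periodic f (2 * π)) (x : ℝ) :
    HasDerivAt (hilbertC f) (hilbertC (deriv f) x) x := by
  have hc1 := fourierCoef_deriv (hf.of_le (by norm_num)) hper
  obtain ⟨C, hbound⟩ := exists_norm_fourierCoef_deriv_le hf hper
  have hsum : Summable fun k : ℤ => C * (1 / (k : ℝ) ^ 2) :=
    (Real.summable_one_div_int_pow.mpr one_lt_two).mul_left C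
  have hle (k : ℤ) (hk : k ≠ 0) : ‖fourierCoef f k‖ ≤ ‖fourierCoef (deriv f) k‖ := by
    rw [hc1, norm_mul, norm_mul, Complex.norm_I, Complex.norm_intCast, one_mul]
    exact le_mul_of_one_le_left (norm_nonneg _) (by exact_mod_cast Int.one_le_abs hk)
  have hterm (c : ℂ) (k : ℤ) (y : ℝ) (hc : k ≠ 0 → ‖c‖ ≤ C * (1 / (k : ℝ) ^ 2)) :
      ‖-Complex.I * (Int.sign k : ℂ) * c * Complex.exp (Complex.I * k * y)‖
        ≤ C * (1 / (k : ℝ) ^ 2) := by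
    rcases eq_or_ne k 0 with rfl | hk
    · simp
    · have hsign : ‖(Int.sign k : ℂ)‖ = 1 := by
        rcases hk.lt_or_gt with h | h
        · simp [Int.sign_eq_neg_one_of_neg h]
        · simp [Int.sign_eq_one_of_pos h]
      have hexp : ‖Complex.exp (Complex.I * k * y)‖ = 1 := by simp [Complex.norm_exp]
      rw [norm_mul, norm_mul, norm_mul, hsign, hexp, norm_neg, Complex.norm_I, one_mul, one_mul,
        mul_one]
      exact hc hk
  refine hasDerivAt_tsum (y₀ := 0) hsum (fun k y => ?_) (fun k y => hterm _ k y (hbound k))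
    (Summable.of_norm_bounded hsum fun k =>
      hterm _ k 0 fun hk => (hle k hk).trans (hbound k hk)) x
  have he : HasDerivAt (fun y : ℝ => Complex.exp (Complex.I * k * y))
      (Complex.exp (Complex.I * k * y) * (Complex.I * k)) y := by
    simpa using (((hasDerivAt_id y).ofReal_comp).const_mul (Complex.I * k)).cexp
  refine (he.const_mul (-Complex.I * (Int.sign k : ℂ) * fourierCoef f k)).congr_deriv ?_
  rw [hc1]
  ring

theorem periodic_hilbertR (f : ℝ → ℝ) : Function.Periodic (hilbertR f) (2 * π) := fun x => by
  unfold hilbertR hilbertC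
  congr 2 with k
  congr 1
  rw [Complex.exp_eq_exp_iff_exists_int]
  exact ⟨k, by push_cast; ring⟩

theorem hasDerivAt_hilbertR {f : ℝ → ℝ} (hf : ContDiff ℝ 3 f)
    (hper : Function.Periodic f (2 * π)) (x : ℝ) :
    HasDerivAt (hilbertR f) (hilbertR (deriv f) x) x := by
  have hderiv : deriv (fun y => (f y : ℂ)) = fun y => ((deriv f y : ℝ) : ℂ) :=
    funext fun y => ((hf.differentiable (by norm_num) y).hasDerivAt.ofReal_comp).deriv
  have h := hasDerivAt_hilbertC (f := fun y => (f y : ℂ))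
    (Complex.ofRealCLM.contDiff.comp hf) (fun y => by simp [hper y]) x
  rw [hderiv] at h
  exact Complex.reCLM.hasFDerivAt.comp_hasDerivAt x h

theorem hasDerivAt_deriv_comm {Φ : ℝ × ℝ → ℝ} (hΦ : ContDiff ℝ 2 Φ) (t x : ℝ) :
    HasDerivAt (fun y => deriv (fun s => Φ (s, y)) t)
      (deriv (fun s => deriv (fun y => Φ (s, y)) x) t) x := by
  have hd1 (s y : ℝ) : HasDerivAt (fun s => Φ (s, y)) (fderiv ℝ Φ (s, y) (1, 0)) s :=
    (hΦ.differentiable two_ne_zero (s, y)).hasFDerivAt.comp_hasDerivAt s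
      ((hasDerivAt_id s).prodMk (hasDerivAt_const s y))
  have hd2 (s y : ℝ) : HasDerivAt (fun y => Φ (s, y)) (fderiv ℝ Φ (s, y) (0, 1)) y :=
    (hΦ.differentiable two_ne_zero (s, y)).hasFDerivAt.comp_hasDerivAt y
      ((hasDerivAt_const y s).prodMk (hasDerivAt_id y))
  have hΦ' : HasFDerivAt (fderiv ℝ Φ) (fderiv ℝ (fderiv ℝ Φ) (t, x)) (t, x) :=
    ((hΦ.fderiv_right (m := 1) (by norm_num)).differentiable one_ne_zero (t, x)).hasFDerivAt
  have happ (v : ℝ × ℝ) : HasFDerivAt (fun p => fderiv ℝ Φ p v)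
      ((ContinuousLinearMap.apply ℝ ℝ v).comp (fderiv ℝ (fderiv ℝ Φ) (t, x))) (t, x) :=
    (ContinuousLinearMap.apply ℝ ℝ v).hasFDerivAt.comp (t, x) hΦ'
  have h1 : HasDerivAt (fun s => fderiv ℝ Φ (s, x) (0, 1))
      (fderiv ℝ (fderiv ℝ Φ) (t, x) (1, 0) (0, 1)) t :=
    (happ (0, 1)).comp_hasDerivAt (f := fun s => (s, x)) t
      ((hasDerivAt_id t).prodMk (hasDerivAt_const t x))
  have h2 : HasDerivAt (fun y => fderiv ℝ Φ (t, y) (1, 0))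
      (fderiv ℝ (fderiv ℝ Φ) (t, x) (0, 1) (1, 0)) x :=
    (happ (1, 0)).comp_hasDerivAt (f := fun y => (t, y)) x
      ((hasDerivAt_const x t).prodMk (hasDerivAt_id x))
  simp only [fun s y => (hd1 s y).deriv, fun s y => (hd2 s y).deriv]
  rw [h1.deriv, (hΦ.contDiffAt.isSymmSndFDerivAt (by simp)).eq]
  exact h2

theorem hasDerivAt_integral_of_contDiff {Φ : ℝ × ℝ → ℝ} (hΦ : ContDiff ℝ 1 Φ) (a b t : ℝ) :
    HasDerivAt (fun s => ∫ y in a..b, Φ (s, y)) (∫ y in a..b, deriv (fun s => Φ (s, y)) t) t := by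
  have hd (s y : ℝ) : HasDerivAt (fun s => Φ (s, y)) (fderiv ℝ Φ (s, y) (1, 0)) s :=
    (hΦ.differentiable one_ne_zero (s, y)).hasFDerivAt.comp_hasDerivAt s
      ((hasDerivAt_id s).prodMk (hasDerivAt_const s y))
  have hcont : Continuous fun p => fderiv ℝ Φ p (1, 0) :=
    (hΦ.continuous_fderiv one_ne_zero).clm_apply continuous_const
  obtain ⟨M, hM⟩ := ((isCompact_closedBall t 1).prod (isCompact_uIcc (a := a) (b := b))
    ).exists_bound_of_continuousOn hcont.continuousOn
  simp only [fun s y => (hd s y).deriv]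
  refine (intervalIntegral.hasDerivAt_integral_of_dominated_loc_of_deriv_le (bound := fun _ => M)
    (F' := fun s y => fderiv ℝ Φ (s, y) (1, 0))
    (Metric.closedBall_mem_nhds t one_pos) (.of_forall fun s => ?_) ?_ ?_ ?_ ?_ ?_).2
  · exact (hΦ.continuous.comp (Continuous.prodMk_right s)).aestronglyMeasurable
  · exact (hΦ.continuous.comp (Continuous.prodMk_right t)).intervalIntegrable _ _
  · exact (hcont.comp (Continuous.prodMk_right t)).aestronglyMeasurable
  · exact .of_forall fun y hy s hs => hM (s, y) ⟨hs, Set.uIoc_subset_uIcc hy⟩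
  · exact intervalIntegrable_const
  · exact .of_forall fun y _ s _ => hd s y

/-- **Equation for the antiderivative (first step of Tao's gauge transform).** If `u` solves
`∂ₜu + H∂ₓ²u + u∂ₓu = g` on `[0,T] × ℝ` (both smooth, `2π`-periodic and of zero mean in `x`)
and `F(t,·)` (resp. `G(t,·)`) is the zero-mean `2π`-periodic antiderivative of `u(t,·)`
(resp. `g(t,·)`), then `∂ₜF + H∂ₓ²F + ½(∂ₓF)² = (1/4π)∫₀^{2π}(∂ₓF)² dy + G` pointwise. -/
theorem antiderivative_equation (T : ℝ) (hT : 0 < T) (u g F G : ℝ → ℝ → ℝ)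
    (hu : ContDiff ℝ (⊤ : ℕ∞) (fun p : ℝ × ℝ => u p.1 p.2))
    (hg : ContDiff ℝ (⊤ : ℕ∞) (fun p : ℝ × ℝ => g p.1 p.2))
    (huper : ∀ t x : ℝ, u t (x + 2 * π) = u t x)
    (hgper : ∀ t x : ℝ, g t (x + 2 * π) = g t x)
    (humean : ∀ t : ℝ, ∫ x in (0:ℝ)..(2 * π), u t x = 0)
    (hgmean : ∀ t : ℝ, ∫ x in (0:ℝ)..(2 * π), g t x = 0)
    (hF : ContDiff ℝ (⊤ : ℕ∞) (fun p : ℝ × ℝ => F p.1 p.2))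
    (hFper : ∀ t x : ℝ, F t (x + 2 * π) = F t x)
    (hFderiv : ∀ t x : ℝ, deriv (F t) x = u t x)
    (hFmean : ∀ t : ℝ, ∫ x in (0:ℝ)..(2 * π), F t x = 0)
    (hG : ContDiff ℝ (⊤ : ℕ∞) (fun p : ℝ × ℝ => G p.1 p.2))
    (hGper : ∀ t x : ℝ, G t (x + 2 * π) = G t x)
    (hGderiv : ∀ t x : ℝ, deriv (G t) x = g t x)
    (hGmean : ∀ t : ℝ, ∫ x in (0:ℝ)..(2 * π), G t x = 0)
    (hPDE : ∀ t ∈ Set.Icc (0:ℝ) T, ∀ x : ℝ,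
      deriv (fun s => u s x) t + hilbertR (iteratedDeriv 2 (u t)) x
        + u t x * deriv (u t) x = g t x) :
    ∀ t ∈ Set.Icc (0:ℝ) T, ∀ x : ℝ,
      deriv (fun s => F s x) t + hilbertR (iteratedDeriv 2 (F t)) x
        + (1 / 2) * (deriv (F t) x) ^ 2
      = (1 / (4 * π)) * (∫ y in (0:ℝ)..(2 * π), (deriv (F t) y) ^ 2) + G t x := by
  intro t ht x
  have hslice {f : ℝ → ℝ → ℝ} (hf : ContDiff ℝ (⊤ : ℕ∞) (fun p : ℝ × ℝ => f p.1 p.2)) (s : ℝ) :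
      ContDiff ℝ (⊤ : ℕ∞) (f s) := hf.comp (contDiff_const.prodMk contDiff_id)
  have hFu (s : ℝ) : deriv (F s) = u s := funext (hFderiv s)
  have hut := hslice hu t
  have hud : ContDiff ℝ (⊤ : ℕ∞) (deriv (u t)) := (contDiff_infty_iff_deriv.mp hut).2
  have hudper : Function.Periodic (deriv (u t)) (2 * π) := fun y => by
    rw [← deriv_comp_add_const, (funext (huper t) : (fun y => u t (y + 2 * π)) = u t)]
  have hF2 : iteratedDeriv 2 (F t) = deriv (u t) := by
    rw [iteratedDeriv_succ, iteratedDeriv_one, hFu]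
  have hu2 : iteratedDeriv 2 (u t) = deriv (deriv (u t)) := by
    rw [iteratedDeriv_succ, iteratedDeriv_one]
  have h3 : (3 : WithTop ℕ∞) ≤ ((⊤ : ℕ∞) : WithTop ℕ∞) :=
    WithTop.coe_le_coe.mpr le_top
  have hA (y : ℝ) : HasDerivAt (fun y => deriv (fun s => F s y) t)
      (deriv (fun s => u s y) t) y := by
    have h := hasDerivAt_deriv_comm (hF.of_le (WithTop.coe_le_coe.mpr le_top)) t y
    simpa only [hFderiv] using h
  have hB := hasDerivAt_hilbertR (hut.of_le h3) (huper t)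
  have hB' := hasDerivAt_hilbertR (hud.of_le h3) hudper
  have hC (y : ℝ) : HasDerivAt (fun y => (1 / 2) * u t y ^ 2) (u t y * deriv (u t) y) y := by
    refine (((hut.differentiable (by simp) y).hasDerivAt.pow 2).const_mul (1 / 2)).congr_deriv ?_
    ring
  have hG' (y : ℝ) : HasDerivAt (G t) (g t y) y := by
    rw [← hGderiv]
    exact ((hslice hG t).differentiable (by simp) y).hasDerivAt
  have hD (y : ℝ) : HasDerivAt (fun y => deriv (fun s => F s y) t + hilbertR (deriv (u t)) y
      + (1 / 2) * u t y ^ 2 - G t y) 0 y := by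
    refine ((((hA y).add (hB' y)).add (hC y)).sub (hG' y)).congr_deriv ?_
    rw [← hPDE t ht y, hu2]
    ring
  have hconst (y : ℝ) := is_const_of_deriv_eq_zero (fun y => (hD y).differentiableAt)
    (fun y => (hD y).deriv) y x
  have hAint : ∫ y in (0:ℝ)..(2 * π), deriv (fun s => F s y) t = 0 := by
    have h := hasDerivAt_integral_of_contDiff
      (hF.of_le (WithTop.coe_le_coe.mpr le_top)) 0 (2 * π) t
    simp only [hFmean] at h
    exact h.unique (hasDerivAt_const t 0)
  have hcA : Continuous fun y => deriv (fun s => F s y) t :=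
    continuous_iff_continuousAt.mpr fun y => (hA y).continuousAt
  have hcB : Continuous (hilbertR (deriv (u t))) :=
    continuous_iff_continuousAt.mpr fun y => (hB' y).continuousAt
  have hBint : ∫ y in (0:ℝ)..(2 * π), hilbertR (deriv (u t)) y = 0 := by
    rw [intervalIntegral.integral_eq_sub_of_hasDerivAt (fun y _ => hB y)
      (hcB.intervalIntegrable _ _)]
    simpa [sub_eq_zero] using periodic_hilbertR (u t) 0
  have hcAB : Continuous fun y => deriv (fun s => F s y) t + hilbertR (deriv (u t)) y :=
    hcA.add hcB
  have hcC : Continuous fun y => (1 / 2) * u t y ^ 2 := by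
    have := hut.continuous
    fun_prop
  have hcABC : Continuous fun y => deriv (fun s => F s y) t + hilbertR (deriv (u t)) y
      + (1 / 2) * u t y ^ 2 := hcAB.add hcC
  have hint := intervalIntegral.integral_congr (μ := volume) (a := 0) (b := 2 * π)
    fun y _ => hconst y
  rw [intervalIntegral.integral_sub
      (hcABC.intervalIntegrable _ _)
      ((hslice hG t).continuous.intervalIntegrable _ _),
    intervalIntegral.integral_add (hcAB.intervalIntegrable _ _)
      (hcC.intervalIntegrable _ _),
    intervalIntegral.integral_add (hcA.intervalIntegrable _ _) (hcB.intervalIntegrable _ _),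
    hAint, hBint, hGmean, intervalIntegral.integral_const_mul, intervalIntegral.integral_const]
    at hint
  simp only [hFderiv, hF2]
  simp only [zero_add, sub_zero, smul_eq_mul] at hint
  have hpi := Real.pi_ne_zero
  rw [← sub_eq_iff_eq_add]
  field_simp at hint ⊢
  linarith
end
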